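/- arXiv:0806.1276 — 2 statements merged into one kernel-verified Lean document; each statement's English description precedes it below -/
import Mathlib

section
/- Let μ be a Borel probability measure on ℝ^d. Then B_μ(q) ≤ Λ_μ(q) for every q ∈ ℝ, and B_μ(1) = Λ_μ(1) = 0. -/
open Filter Set Metric MeasureTheory Topology ENNReal

noncomputable section

variable {X : Type*} [MetricSpace X] [MeasurableSpace X]

/-- The (topological) support of a Borel measure. -/
def msupp (μ : Measure X) : Set X := {x | ∀ r > 0, 0 < μ (ball x r)}

/-- `(B(x i, r i))_{i ∈ I}` is a centered `ε`-packing of `E` : the centers lie in `E`,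
the radii are positive and at most `ε`, and the closed balls are pairwise disjoint. -/
def IsCPacking (E : Set X) (ε : ℝ) (I : Set ℕ) (x : ℕ → X) (r : ℕ → ℝ) : Prop :=
  (∀ i ∈ I, x i ∈ E ∧ 0 < r i ∧ r i ≤ ε) ∧
  I.PairwiseDisjoint (fun i => closedBall (x i) (r i))

/-- The sum `Σ_i μ(B(x_i,r_i))^q (2 r_i)^t` associated to a packing.  Note that
`ENNReal.rpow` satisfies exactly the conventions `0^q = ∞` for `q < 0` and `0^0 = 1`. -/
def packSum (μ : Measure X) (q t : ℝ) (I : Set ℕ) (x : ℕ → X) (r : ℕ → ℝ) : ℝ≥0∞ :=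
  ∑' i : I, μ (closedBall (x i.1) (r i.1)) ^ q * ENNReal.ofReal (2 * r i.1) ^ t

/-- `P̄^{q,t}_{μ,ε}(E)`. -/
def prePackPre (μ : Measure X) (q t ε : ℝ) (E : Set X) : ℝ≥0∞ :=
  ⨆ (I : Set ℕ) (x : ℕ → X) (r : ℕ → ℝ) (_ : IsCPacking E ε I x r), packSum μ q t I x r

/-- The prepacking measure `P̄^{q,t}_μ(E) = lim_{ε→0} P̄^{q,t}_{μ,ε}(E)`;
since `ε ↦ P̄^{q,t}_{μ,ε}(E)` is monotone, the limit is the infimum over `ε > 0`. -/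
def prePack (μ : Measure X) (q t : ℝ) (E : Set X) : ℝ≥0∞ :=
  ⨅ (ε : ℝ) (_ : 0 < ε), prePackPre μ q t ε E

/-- The packing measure `P^{q,t}_μ(E)`, obtained from `P̄^{q,t}_μ` by countable covers. -/
def packMeas (μ : Measure X) (q t : ℝ) (E : Set X) : ℝ≥0∞ :=
  ⨅ (F : ℕ → Set X) (_ : E ⊆ ⋃ i, F i), ∑' i, prePack μ q t (F i)

/-- The prepacking dimension `Δ^q_μ(E) = inf {t : P̄^{q,t}_μ(E) = 0}` (`+∞` if no such `t`). -/
def mfDelta (μ : Measure X) (q : ℝ) (E : Set X) : EReal :=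
  ⨅ (t : ℝ) (_ : prePack μ q t E = 0), (t : EReal)

/-- The packing dimension `Dim^q_μ(E) = inf {t : P^{q,t}_μ(E) = 0}` (`+∞` if no such `t`). -/
def mfDim (μ : Measure X) (q : ℝ) (E : Set X) : EReal :=
  ⨅ (t : ℝ) (_ : packMeas μ q t E = 0), (t : EReal)

/-- `Dim(E) = Dim^0_μ(E)`, the packing dimension. -/
def pDim (μ : Measure X) (E : Set X) : EReal := mfDim μ 0 E

/-- `Δ(E) = Δ^0_μ(E)`, the prepacking dimension. -/
def pDelta (μ : Measure X) (E : Set X) : EReal := mfDelta μ 0 E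

/-- `B_μ(q) = Dim^q_μ(supp μ)`. -/
def Bmu (μ : Measure X) (q : ℝ) : EReal := mfDim μ q (msupp μ)

/-- `Λ_μ(q) = Δ^q_μ(supp μ)`. -/
def Lammu (μ : Measure X) (q : ℝ) : EReal := mfDelta μ q (msupp μ)

/-- `X̄^α = {x ∈ supp μ : limsup_{r→0} log μ(B(x,r)) / log r ≤ α}`. -/
def Xbar (μ : Measure X) (α : ℝ) : Set X :=
  {x ∈ msupp μ |
    limsup (fun r => Real.log (μ (closedBall x r)).toReal / Real.log r) (𝓝[>] (0:ℝ)) ≤ α}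

/-- `X_α(η,p) = {x ∈ X̄^α : ∀ r > 0, 2r ≥ 1/p or (2r)^η ≤ μ(B(x,r))}`. -/
def Xae (μ : Measure X) (α η : ℝ) (p : ℕ) : Set X :=
  {x ∈ Xbar μ α |
    ∀ r : ℝ, 0 < r →
      (1 : ℝ) / (p : ℝ) ≤ 2 * r ∨ ENNReal.ofReal ((2 * r) ^ η) ≤ μ (closedBall x r)}

/-- Property `P_k` : the family `(B(y i, δ i))_{i ∈ I}` splits into at most `k` parts,
each of which is a centered `uε`-packing of `M`. -/
def HasPk (M : Set X) (uε : ℝ) (k : ℕ) (I : Set ℕ) (y : ℕ → X) (δ : ℕ → ℝ) : Prop :=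
  ∃ c : ℕ → Fin k, ∀ j : Fin k, IsCPacking M uε {i ∈ I | c i = j} y δ

/-- `L^k_{ε,(B(x_i,r_i))}(M)` : infimum over families with property `P_k` of
`sup_{i∈I} log μ(B(y_i,δ_i)) / log (2 r_i)`. -/
def Lpack (μ : Measure X) (u : ℝ → ℝ) (k : ℕ) (ε : ℝ) (M : Set X)
    (I : Set ℕ) (x : ℕ → X) (r : ℕ → ℝ) : EReal :=
  ⨅ (y : ℕ → X) (δ : ℕ → ℝ) (_ : HasPk M (u ε) k I y δ),
    ⨆ i : I,
      ((Real.log (μ (closedBall (y i.1) (δ i.1))).toReal / Real.log (2 * r i.1) : ℝ) : EReal)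

/-- `L^k_ε(M)` : supremum over all centered `ε`-packings of `M`. -/
def Leps (μ : Measure X) (u : ℝ → ℝ) (k : ℕ) (ε : ℝ) (M : Set X) : EReal :=
  ⨆ (I : Set ℕ) (x : ℕ → X) (r : ℕ → ℝ) (_ : IsCPacking M ε I x r),
    Lpack μ u k ε M I x r

/-- `L^k(M) = lim_{ε→0} L^k_ε(M)`; the function being monotone in `ε`,
the limit is the infimum over `ε > 0`. -/
def Lk (μ : Measure X) (u : ℝ → ℝ) (k : ℕ) (M : Set X) : EReal :=
  ⨅ (ε : ℝ) (_ : 0 < ε), Leps μ u k ε M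

/-- `L(M) = lim_{k→∞} L^k(M)`; the sequence being nonincreasing, this is the infimum. -/
def Lfun (μ : Measure X) (u : ℝ → ℝ) (M : Set X) : EReal :=
  ⨅ (k : ℕ) (_ : 1 ≤ k), Lk μ u k M

/-- `T_μ(α,η,p) = sup {L(M) : M ⊆ X_α(η,p)}`. -/
def Tp (μ : Measure X) (u : ℝ → ℝ) (α η : ℝ) (p : ℕ) : EReal :=
  ⨆ (M : Set X) (_ : M ⊆ Xae μ α η p), Lfun μ u M

/-- `T_μ(α,η) = lim_{p→∞} T_μ(α,η,p)`; the sequence being nondecreasing, this is the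
supremum over `p ≥ 1`. -/
def Teta (μ : Measure X) (u : ℝ → ℝ) (α η : ℝ) : EReal :=
  ⨆ (p : ℕ) (_ : 1 ≤ p), Tp μ u α η p

/-- `T_μ(α) = lim_{η→α⁺} T_μ(α,η)`; the function being nondecreasing in `η`, this is the
infimum over `η > α`. -/
def Tfun (μ : Measure X) (u : ℝ → ℝ) (α : ℝ) : EReal :=
  ⨅ (η : ℝ) (_ : α < η), Teta μ u α η

theorem prePack_empty (μ : Measure X) (q t : ℝ) : prePack μ q t ∅ = 0 := by
  refine le_antisymm (iInf₂_le_of_le 1 one_pos ?_) zero_le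
  refine iSup_le fun I => iSup_le fun x => iSup_le fun r => iSup_le fun h => ?_
  have hI : I = ∅ := Set.eq_empty_of_forall_notMem fun i hi => (h.1 i hi).1
  subst hI
  simp [packSum]

theorem packMeas_le_prePack (μ : Measure X) (q t : ℝ) (E : Set X) :
    packMeas μ q t E ≤ prePack μ q t E := by
  refine iInf₂_le_of_le (fun i => if i = 0 then E else ∅)
    (fun y hy => mem_iUnion.2 ⟨0, by simpa using hy⟩) ?_
  rw [tsum_eq_single 0 (fun i hi => by simp [hi, prePack_empty])]
  simp

theorem mfDim_le_mfDelta (μ : Measure X) (q : ℝ) (E : Set X) :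
    mfDim μ q E ≤ mfDelta μ q E :=
  le_iInf₂ fun t ht => iInf₂_le (f := fun (t : ℝ) (_ : packMeas μ q t E = 0) => (t : EReal)) t
    (le_antisymm ((packMeas_le_prePack μ q t E).trans ht.le) zero_le)

theorem prePackPre_one_le [BorelSpace X] (μ : Measure X) [IsProbabilityMeasure μ] {t : ℝ}
    (ht : 0 < t) (ε : ℝ) (E : Set X) :
    prePackPre μ 1 t ε E ≤ ENNReal.ofReal (2 * ε) ^ t := by
  refine iSup_le fun I => iSup_le fun x => iSup_le fun r => iSup_le fun h => ?_
  calc packSum μ 1 t I x r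
      ≤ ∑' i : I, μ (closedBall (x i) (r i)) * ENNReal.ofReal (2 * ε) ^ t := by
        refine ENNReal.tsum_le_tsum fun i => ?_
        rw [ENNReal.rpow_one]
        have := (h.1 i i.2).2.2
        gcongr
    _ = μ (⋃ i ∈ I, closedBall (x i) (r i)) * ENNReal.ofReal (2 * ε) ^ t := by
        rw [ENNReal.tsum_mul_right, measure_biUnion I.to_countable h.2
          fun i _ => isClosed_closedBall.measurableSet]
    _ ≤ ENNReal.ofReal (2 * ε) ^ t := mul_le_of_le_one_left zero_le prob_le_one

theorem prePack_one_eq_zero [BorelSpace X] (μ : Measure X) [IsProbabilityMeasure μ] {t : ℝ}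
    (ht : 0 < t) (E : Set X) : prePack μ 1 t E = 0 := by
  refine le_antisymm ?_ zero_le
  have hlim : Tendsto (fun ε : ℝ => ENNReal.ofReal (2 * ε) ^ t) (𝓝[>] 0) (𝓝 0) := by
    have hc : Continuous fun ε : ℝ => ENNReal.ofReal (2 * ε) ^ t :=
      ENNReal.continuous_rpow_const.comp (ENNReal.continuous_ofReal.comp (by fun_prop))
    have := (hc.tendsto 0).mono_left (nhdsWithin_le_nhds (s := Ioi 0))
    simpa [ENNReal.zero_rpow_of_pos ht] using this
  refine ge_of_tendsto hlim ?_
  filter_upwards [self_mem_nhdsWithin] with ε hε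
  exact iInf₂_le_of_le ε hε (prePackPre_one_le μ ht ε E)

theorem mfDelta_one_le_zero [BorelSpace X] (μ : Measure X) [IsProbabilityMeasure μ] (E : Set X) :
    mfDelta μ 1 E ≤ 0 := by
  refine EReal.le_of_forall_lt_iff_le.1 fun t ht => ?_
  exact iInf₂_le t (prePack_one_eq_zero μ (by exact_mod_cast ht) E)

/-- By the Besicovitch covering theorem, almost all of `E` is covered by a packing of `E`
with balls of diameter at most one. -/
theorem measure_le_prePack_one [SecondCountableTopology X] [OpensMeasurableSpace X]
    [HasBesicovitchCovering X] (μ : Measure X) [SFinite μ] {t : ℝ} (ht : t ≤ 0) (E : Set X) :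
    μ E ≤ prePack μ 1 t E := by
  refine le_iInf₂ fun ε hε => ?_
  rcases E.eq_empty_or_nonempty with rfl | ⟨e, -⟩
  · simp
  obtain ⟨s, ρ, hs, hsE, hρ, hcov, hdisj⟩ :=
    Besicovitch.exists_disjoint_closedBall_covering_ae μ (fun _ => Ioi 0) E
      (fun x _ δ hδ => ⟨δ / 2, half_pos hδ, half_pos hδ, half_lt_self hδ⟩)
      (fun _ => min ε (1 / 2)) (fun _ _ => lt_min hε one_half_pos)
  have : Nonempty X := ⟨e⟩
  obtain ⟨f, hf⟩ := Set.countable_iff_exists_injOn.1 hs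
  have hinv : LeftInvOn (Function.invFunOn f s) f s := hf.leftInvOn_invFunOn
  set g := Function.invFunOn f s
  have hg : ∀ i ∈ f '' s, g i ∈ s := by
    rintro _ ⟨y, hy, rfl⟩
    rwa [hinv hy]
  have hpack : IsCPacking E ε (f '' s) g (ρ ∘ g) := by
    refine ⟨fun i hi => ⟨hsE (hg i hi), (hρ _ (hg i hi)).1,
      (hρ _ (hg i hi)).2.2.le.trans (min_le_left _ _)⟩, ?_⟩
    rintro _ ⟨y, hy, rfl⟩ _ ⟨z, hz, rfl⟩ hne
    simp only [Function.onFun, Function.comp, hinv hy, hinv hz]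
    exact hdisj hy hz fun h => hne (h ▸ rfl)
  calc μ E ≤ μ (⋃ y ∈ s, closedBall y (ρ y)) :=
        measure_mono_ae (ae_le_set.2 hcov)
    _ ≤ μ (⋃ i ∈ f '' s, closedBall (g i) ((ρ ∘ g) i)) := by
        refine measure_mono (iUnion₂_subset fun y hy => ?_)
        refine Subset.trans ?_ (subset_biUnion_of_mem (mem_image_of_mem f hy))
        simp [hinv hy]
    _ ≤ ∑' i : f '' s, μ (closedBall (g i) ((ρ ∘ g) i)) :=
        measure_biUnion_le μ (f '' s).to_countable _
    _ ≤ packSum μ 1 t (f '' s) g (ρ ∘ g) := by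
        refine ENNReal.tsum_le_tsum fun i => ?_
        rw [ENNReal.rpow_one]
        refine le_mul_of_one_le_right zero_le ?_
        have := (hρ _ (hg i i.2)).2.2.le.trans (min_le_right _ _)
        have hle : ENNReal.ofReal (2 * (ρ ∘ g) i) ≤ 1 := by
          rw [ENNReal.ofReal_le_one, Function.comp_apply]
          linarith
        simpa [ENNReal.rpow_neg] using ENNReal.rpow_le_one hle (neg_nonneg.2 ht)
    _ ≤ prePackPre μ 1 t ε E :=
        le_iSup_of_le _ <| le_iSup_of_le _ <| le_iSup_of_le _ <| le_iSup_of_le hpack le_rfl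

theorem measure_le_packMeas_one [SecondCountableTopology X] [OpensMeasurableSpace X]
    [HasBesicovitchCovering X] (μ : Measure X) [SFinite μ] {t : ℝ} (ht : t ≤ 0) (E : Set X) :
    μ E ≤ packMeas μ 1 t E :=
  le_iInf₂ fun F hF => (measure_mono hF).trans <| (measure_iUnion_le F).trans <|
    ENNReal.tsum_le_tsum fun i => measure_le_prePack_one μ ht (F i)

theorem zero_le_mfDim_one [SecondCountableTopology X] [OpensMeasurableSpace X]
    [HasBesicovitchCovering X] (μ : Measure X) [SFinite μ] {E : Set X} (hE : μ E ≠ 0) :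
    0 ≤ mfDim μ 1 E := by
  refine le_iInf₂ fun t ht => ?_
  by_contra! hlt
  have h0 : t ≤ 0 := le_of_lt (by exact_mod_cast hlt)
  exact hE (le_antisymm ((measure_le_packMeas_one μ h0 E).trans ht.le) zero_le)

theorem measure_compl_msupp [SecondCountableTopology X] (μ : Measure X) :
    μ (msupp μ)ᶜ = 0 := by
  refine measure_null_of_locally_null _ fun x hx => ?_
  simp only [msupp, mem_compl_iff, mem_ofPred_eq, not_forall, not_lt, nonpos_iff_eq_zero] at hx
  obtain ⟨r, hr, h0⟩ := hx
  exact ⟨ball x r, mem_nhdsWithin_of_mem_nhds (ball_mem_nhds x hr), h0⟩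

theorem measure_msupp_ne_zero [SecondCountableTopology X] (μ : Measure X) [NeZero μ] :
    μ (msupp μ) ≠ 0 := fun h =>
  NeZero.ne μ <| Measure.measure_univ_eq_zero.1 <| by
    rw [← union_compl_self (msupp μ)]
    exact measure_union_null h (measure_compl_msupp μ)

/-- **Proposition 1.i.** `B_μ ≤ Λ_μ` and `B_μ(1) = Λ_μ(1) = 0`. -/
theorem Bmu_le_Lammu_and_eq_zero (d : ℕ) (μ : Measure (EuclideanSpace ℝ (Fin d)))
    [IsProbabilityMeasure μ] :
    (∀ q : ℝ, Bmu μ q ≤ Lammu μ q) ∧ Bmu μ 1 = 0 ∧ Lammu μ 1 = 0 := by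
  have hle : Lammu μ 1 ≤ 0 := mfDelta_one_le_zero μ _
  have hBL : ∀ q : ℝ, Bmu μ q ≤ Lammu μ q := fun q => mfDim_le_mfDelta μ q _
  have hge : 0 ≤ Bmu μ 1 := zero_le_mfDim_one μ (measure_msupp_ne_zero μ)
  exact ⟨hBL, le_antisymm ((hBL 1).trans hle) hge, le_antisymm hle (hge.trans (hBL 1))⟩

end
end

section
/- Let μ be a Borel probability measure on ℝ^d, α ≥ 0, η > α, p ≥ 1 an integer, and let M ⊆ X_α(η,p). Let γ > 0, t < 0 and λ > L(M). If P̄^{γ−t, ηt}_μ(M) < ∞, then Δ(M) ≤ γλ. -/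
open Filter Set Metric MeasureTheory Topology ENNReal

noncomputable section

variable {X : Type*} [MetricSpace X] [MeasurableSpace X]

theorem IsCPacking.mono {E : Set X} {ε ε' : ℝ} {I : Set ℕ} {x : ℕ → X} {r : ℕ → ℝ}
    (h : IsCPacking E ε I x r) (hε : ε ≤ ε') : IsCPacking E ε' I x r :=
  ⟨fun i hi => ⟨(h.1 i hi).1, (h.1 i hi).2.1, (h.1 i hi).2.2.trans hε⟩, h.2⟩

theorem IsCPacking.packSum_le_prePackPre (μ : Measure X) (q t : ℝ) {E : Set X} {ε : ℝ} {I : Set ℕ}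
    {x : ℕ → X} {r : ℕ → ℝ} (h : IsCPacking E ε I x r) :
    packSum μ q t I x r ≤ prePackPre μ q t ε E :=
  le_iSup_of_le I <| le_iSup_of_le x <| le_iSup_of_le r <| le_iSup_of_le h le_rfl

theorem prePackPre_mono (μ : Measure X) (q t : ℝ) (E : Set X) {ε ε' : ℝ} (hε : ε ≤ ε') :
    prePackPre μ q t ε E ≤ prePackPre μ q t ε' E :=
  iSup_le fun _ => iSup_le fun _ => iSup_le fun _ => iSup_le fun h =>
    (h.mono hε).packSum_le_prePackPre μ q t

theorem IsCPacking.Lpack_le_Leps (μ : Measure X) (u : ℝ → ℝ) (k : ℕ) {M : Set X} {ε : ℝ}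
    {I : Set ℕ} {x : ℕ → X} {r : ℕ → ℝ} (h : IsCPacking M ε I x r) :
    Lpack μ u k ε M I x r ≤ Leps μ u k ε M := by
  unfold Leps
  exact le_iSup_of_le I <| le_iSup_of_le x <| le_iSup_of_le r <| le_iSup_of_le h le_rfl

/-- A packing by balls of measure at least `c` has `∑ μ(B)^γ ≤ 1 / c`, for a probability measure. -/
theorem tsum_measure_rpow_le_inv [OpensMeasurableSpace X] (μ : Measure X) [IsProbabilityMeasure μ]
    {J : Set ℕ} {y : ℕ → X} {δ : ℕ → ℝ} {γ : ℝ} {c : ℝ≥0∞}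
    (hd : J.PairwiseDisjoint (fun i => closedBall (y i) (δ i)))
    (hγ : 0 ≤ γ) (hc : c ≠ 0) (hJ : ∀ i ∈ J, c ≤ μ (closedBall (y i) (δ i))) :
    ∑' i : J, μ (closedBall (y i.1) (δ i.1)) ^ γ ≤ c⁻¹ := by
  have h1 : ∀ i : J, μ (closedBall (y i.1) (δ i.1)) ^ γ
      ≤ c⁻¹ * μ (closedBall (y i.1) (δ i.1)) := fun i => by
    have hci := hJ i.1 i.2
    have hct : c ≠ ⊤ := ne_top_of_le_ne_top (measure_ne_top μ _) hci
    calc μ (closedBall (y i.1) (δ i.1)) ^ γ ≤ 1 := ENNReal.rpow_le_one prob_le_one hγ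
      _ = c⁻¹ * c := (ENNReal.inv_mul_cancel hc hct).symm
      _ ≤ _ := by gcongr
  calc ∑' i : J, μ (closedBall (y i.1) (δ i.1)) ^ γ
      ≤ ∑' i : J, c⁻¹ * μ (closedBall (y i.1) (δ i.1)) := ENNReal.tsum_le_tsum h1
    _ = c⁻¹ * μ (⋃ i ∈ J, closedBall (y i) (δ i)) := by
        rw [ENNReal.tsum_mul_left,
          measure_biUnion J.to_countable hd fun i _ => isClosed_closedBall.measurableSet]
    _ ≤ c⁻¹ * 1 := by gcongr; exact prob_le_one
    _ = c⁻¹ := mul_one _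

/-- Over a packing of a set on which `(2ρ)^η ≤ μ(B(x,ρ))` at all small scales, the sum of `μ(B)^γ`
is controlled by `P̄^{γ-t,ηt}_{μ,ρ}`, whatever the radii of the packing. -/
theorem IsCPacking.tsum_measure_rpow_le [OpensMeasurableSpace X] {μ : Measure X}
    [IsProbabilityMeasure μ] {M : Set X} {v η γ t ρ : ℝ} (hγ : 0 < γ) (ht : t < 0) (hρ : 0 < ρ)
    (hM : ∀ x ∈ M, ∀ r : ℝ, 0 < r → r ≤ ρ → ENNReal.ofReal (2 * r) ^ η ≤ μ (closedBall x r))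
    {J : Set ℕ} {y : ℕ → X} {δ : ℕ → ℝ} (hJ : IsCPacking M v J y δ) :
    ∑' i : J, μ (closedBall (y i.1) (δ i.1)) ^ γ
      ≤ prePackPre μ (γ - t) (η * t) ρ M + (ENNReal.ofReal (2 * ρ) ^ η)⁻¹ := by
  have hpos : ∀ r : ℝ, 0 < r → ENNReal.ofReal (2 * r) ^ η ≠ 0 := fun r hr =>
    (ENNReal.rpow_pos (by simpa using hr) ENNReal.ofReal_ne_top).ne'
  have hsplit : J = {i ∈ J | δ i ≤ ρ} ∪ {i ∈ J | ρ < δ i} := by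
    ext i
    simp only [mem_union, mem_ofPred_eq, ← and_or_left, le_or_gt, and_true]
  have hsmall : {i ∈ J | δ i ≤ ρ} ⊆ J := fun i hi => hi.1
  have hlarge : {i ∈ J | ρ < δ i} ⊆ J := fun i hi => hi.1
  calc ∑' i : J, μ (closedBall (y i.1) (δ i.1)) ^ γ
      ≤ ∑' i : {i ∈ J | δ i ≤ ρ}, μ (closedBall (y i.1) (δ i.1)) ^ γ
        + ∑' i : {i ∈ J | ρ < δ i}, μ (closedBall (y i.1) (δ i.1)) ^ γ := by
        conv_lhs => rw [hsplit]
        exact ENNReal.tsum_union_le (fun i => μ (closedBall (y i) (δ i)) ^ γ) _ _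
    _ ≤ _ := by
        gcongr
        · have hpack : IsCPacking M ρ {i ∈ J | δ i ≤ ρ} y δ :=
            ⟨fun i hi => ⟨(hJ.1 i hi.1).1, (hJ.1 i hi.1).2.1, hi.2⟩, hJ.2.subset hsmall⟩
          refine le_trans (ENNReal.tsum_le_tsum fun i => ?_)
            (hpack.packSum_le_prePackPre μ (γ - t) (η * t))
          obtain ⟨hyM, hδ, hδρ⟩ := hpack.1 i.1 i.2
          have hball := hM _ hyM _ hδ hδρ
          have hne := ((pos_iff_ne_zero.2 (hpos _ hδ)).trans_le hball).ne'
          calc μ (closedBall (y i.1) (δ i.1)) ^ γ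
              = μ (closedBall (y i.1) (δ i.1)) ^ (γ - t)
                * μ (closedBall (y i.1) (δ i.1)) ^ t := by
                rw [← ENNReal.rpow_add _ _ hne (measure_ne_top μ _), sub_add_cancel]
            _ ≤ _ := by
                rw [ENNReal.rpow_mul]
                refine mul_le_mul_right ?_ _
                rw [← neg_neg t, ENNReal.rpow_neg, ENNReal.rpow_neg _ (-t), ENNReal.inv_le_inv]
                exact ENNReal.rpow_le_rpow hball (neg_nonneg.2 ht.le)
        · refine tsum_measure_rpow_le_inv μ (hJ.2.subset hlarge) hγ.le (hpos ρ hρ) fun i hi => ?_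
          exact (hM _ (hJ.1 i hi.1).1 ρ hρ le_rfl).trans
            (measure_mono (closedBall_subset_closedBall hi.2.le))

/-- If `P̄^{q,t}_{μ,ε}(E)` is finite for some `ε > 0`, then `P̄^{q,s}_μ(E) = 0` for `s > t`. -/
theorem prePack_eq_zero_of_prePackPre_ne_top {μ : Measure X} {E : Set X} {q t s ε : ℝ}
    (hε : 0 < ε) (hts : t < s) (hfin : prePackPre μ q t ε E ≠ ⊤) : prePack μ q s E = 0 := by
  have hbound : ∀ e : ℝ, 0 < e → e ≤ ε →
      prePack μ q s E ≤ ENNReal.ofReal (2 * e) ^ (s - t) * prePackPre μ q t ε E := by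
    intro e he heε
    refine (iInf₂_le e he).trans ?_
    refine iSup_le fun I => iSup_le fun x => iSup_le fun r => iSup_le fun hI => ?_
    refine le_trans ?_ (mul_le_mul_right ((hI.mono heε).packSum_le_prePackPre μ q t) _)
    rw [packSum, packSum, ← ENNReal.tsum_mul_left]
    refine ENNReal.tsum_le_tsum fun i => ?_
    obtain ⟨-, hr, hre⟩ := hI.1 i.1 i.2
    have hr0 : ENNReal.ofReal (2 * r i.1) ≠ 0 := by simpa using hr
    calc μ (closedBall (x i.1) (r i.1)) ^ q * ENNReal.ofReal (2 * r i.1) ^ s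
        = ENNReal.ofReal (2 * r i.1) ^ (s - t)
          * (μ (closedBall (x i.1) (r i.1)) ^ q * ENNReal.ofReal (2 * r i.1) ^ t) := by
          rw [mul_left_comm, ← ENNReal.rpow_add _ _ hr0 ENNReal.ofReal_ne_top, sub_add_cancel]
      _ ≤ _ := by
          gcongr
  have hlim : Tendsto
      (fun e : ℝ => ENNReal.ofReal (2 * e) ^ (s - t) * prePackPre μ q t ε E) (𝓝[>] 0) (𝓝 0) := by
    have hcont : Continuous fun e : ℝ => ENNReal.ofReal (2 * e) ^ (s - t) :=
      (ENNReal.continuous_rpow_const).comp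
        (ENNReal.continuous_ofReal.comp (continuous_const.mul continuous_id))
    have h0 : Tendsto (fun e : ℝ => ENNReal.ofReal (2 * e) ^ (s - t)) (𝓝[>] 0) (𝓝 0) := by
      have := (hcont.tendsto 0).mono_left (nhdsWithin_le_nhds (s := Ioi 0))
      simpa [ENNReal.zero_rpow_of_pos (sub_pos.2 hts)] using this
    simpa using ENNReal.Tendsto.mul_const h0 (Or.inr hfin)
  refine le_antisymm (ge_of_tendsto hlim ?_) zero_le
  filter_upwards [Ioc_mem_nhdsGT hε] with e he using hbound e he.1 he.2

/-- The bound `log m / log a ≤ lam` with `0 < a < 1` amounts to `a ^ lam ≤ m`. -/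
theorem ofReal_rpow_le_of_log_div_log_le {m : ℝ≥0∞} {a lam : ℝ} (hm : m ≠ 0) (hm' : m ≠ ⊤)
    (ha : 0 < a) (ha1 : a < 1) (h : Real.log m.toReal / Real.log a ≤ lam) :
    ENNReal.ofReal a ^ lam ≤ m := by
  rw [ENNReal.ofReal_rpow_of_pos ha]
  refine ENNReal.ofReal_le_of_le_toReal ?_
  rw [div_le_iff_of_neg (Real.log_neg ha ha1)] at h
  rwa [← Real.log_le_log_iff (Real.rpow_pos_of_pos ha _) (ENNReal.toReal_pos hm hm'),
    Real.log_rpow ha]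

/-- If `M ⊆ X_α(η,p)`, `γ > 0`, `t < 0`, `λ > L(M)` and `P̄^{γ-t,ηt}_μ(M) < ∞`,
then `Δ(M) ≤ γλ`. -/
theorem pDelta_le_of_prePack_lt_top (d : ℕ) (μ : Measure (EuclideanSpace ℝ (Fin d)))
    [IsProbabilityMeasure μ]
    (u : ℝ → ℝ) (hu_pos : ∀ ε : ℝ, 0 < ε → 0 < u ε) (hu_ge : ∀ ε : ℝ, 0 < ε → ε ≤ u ε)
    (hu_lim : Tendsto u (𝓝[>] (0:ℝ)) (𝓝 0))
    (α η : ℝ) (hα : 0 ≤ α) (hη : α < η) (p : ℕ) (hp : 1 ≤ p)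
    (M : Set (EuclideanSpace ℝ (Fin d))) (hM : M ⊆ Xae μ α η p)
    (γ t lam : ℝ) (hγ : 0 < γ) (ht : t < 0) (hlam : Lfun μ u M < (lam : EReal))
    (hfin : prePack μ (γ - t) (η * t) M < ⊤) :
    pDelta μ M ≤ ((γ * lam : ℝ) : EReal) := by
  simp only [Lfun, Lk, iInf_lt_iff] at hlam
  obtain ⟨k, -, ε₀, hε₀, hL⟩ := hlam
  simp only [prePack, iInf_lt_iff] at hfin
  obtain ⟨ε₁, hε₁, hfin⟩ := hfin
  have hp0 : (0 : ℝ) < p := by exact_mod_cast hp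
  obtain ⟨ρ, hρ, hρε, hρp⟩ : ∃ ρ : ℝ, 0 < ρ ∧ ρ ≤ ε₁ ∧ 2 * ρ < 1 / p := by
    have hp' : (0 : ℝ) < 1 / p := by positivity
    refine ⟨min ε₁ (1 / p / 4), lt_min hε₁ (by linarith), min_le_left _ _, ?_⟩
    linarith [min_le_right ε₁ (1 / (p : ℝ) / 4)]
  have hball : ∀ x ∈ M, ∀ r : ℝ, 0 < r → r ≤ ρ →
      ENNReal.ofReal (2 * r) ^ η ≤ μ (closedBall x r) := fun x hx r hr hrρ => by
    rw [ENNReal.ofReal_rpow_of_pos (by linarith)]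
    exact ((hM hx).2 r hr).resolve_left (by linarith)
  set C : ℝ≥0∞ := prePackPre μ (γ - t) (η * t) ρ M + (ENNReal.ofReal (2 * ρ) ^ η)⁻¹
  have hCtop : C ≠ ⊤ := by
    refine ENNReal.add_ne_top.2 ⟨ne_top_of_le_ne_top hfin.ne 
      (prePackPre_mono μ _ _ M hρε), ENNReal.inv_ne_top.2 ?_⟩
    exact (ENNReal.rpow_pos (by simpa using hρ) ENNReal.ofReal_ne_top).ne'
  have hbound : prePackPre μ 0 (γ * lam) (min ε₀ (1 / 4)) M ≤ k * C := by
    refine iSup_le fun I => iSup_le fun x => iSup_le fun r => iSup_le fun hI => ?_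
    have hLp : Lpack μ u k ε₀ M I x r < (lam : EReal) :=
      ((hI.mono (min_le_left _ _)).Lpack_le_Leps μ u k).trans_lt hL
    simp only [Lpack, iInf_lt_iff] at hLp
    obtain ⟨y, δ, ⟨c, hc⟩, hsup⟩ := hLp
    have hterm : ∀ i : I, μ (closedBall (x i.1) (r i.1)) ^ (0 : ℝ)
        * ENNReal.ofReal (2 * r i.1) ^ (γ * lam) ≤ μ (closedBall (y i.1) (δ i.1)) ^ γ := by
      intro i
      obtain ⟨-, hr, hr'⟩ := hI.1 i.1 i.2
      obtain ⟨hyM, hδ, -⟩ := (hc (c i.1)).1 i.1 ⟨i.2, rfl⟩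
      have hlog := EReal.coe_le_coe_iff.1 ((le_iSup (fun i : I =>
        ((Real.log (μ (closedBall (y i.1) (δ i.1))).toReal / Real.log (2 * r i.1) : ℝ) : EReal))
        i).trans hsup.le)
      have hpos : μ (closedBall (y i.1) (δ i.1)) ≠ 0 :=
        (((hM hyM).1.1 _ hδ).trans_le (measure_mono ball_subset_closedBall)).ne'
      rw [ENNReal.rpow_zero, one_mul, mul_comm γ, ENNReal.rpow_mul]
      refine ENNReal.rpow_le_rpow ?_ hγ.le
      exact ofReal_rpow_le_of_log_div_log_le hpos (measure_ne_top μ _) (by linarith)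
        (by linarith [min_le_right ε₀ (1 / 4)]) hlog
    have hcover : I = ⋃ j : Fin k, {i ∈ I | c i = j} := by
      ext i
      simp
    calc packSum μ 0 (γ * lam) I x r
        ≤ ∑' i : I, μ (closedBall (y i.1) (δ i.1)) ^ γ := ENNReal.tsum_le_tsum hterm
      _ ≤ ∑ j : Fin k, ∑' i : {i ∈ I | c i = j}, μ (closedBall (y i.1) (δ i.1)) ^ γ := by
          conv_lhs => rw [hcover]
          exact ENNReal.tsum_iUnion_le (fun i => μ (closedBall (y i) (δ i)) ^ γ) _
      _ ≤ ∑ _j : Fin k, C :=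
          Finset.sum_le_sum fun j _ => (hc j).tsum_measure_rpow_le hγ ht hρ hball
      _ = k * C := by simp
  have htop : prePackPre μ 0 (γ * lam) (min ε₀ (1 / 4)) M ≠ ⊤ :=
    ne_top_of_le_ne_top (ENNReal.mul_ne_top (ENNReal.natCast_ne_top k) hCtop) hbound
  refine EReal.le_of_forall_lt_iff_le.1 fun s hs => ?_
  exact iInf₂_le s (prePack_eq_zero_of_prePackPre_ne_top (lt_min hε₀ (by norm_num))
    (EReal.coe_lt_coe_iff.1 hs) htop)


end
end
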